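/- Let n ≥ 1 and let σ, α ∈ S_n be permutations such that the subgroup ⟨σ, α⟩ generated by σ and α acts transitively on {1,…,n}. Then n + 2 − ( #C(σ) + #C(α) + #C(σα) ) is a nonnegative even integer; that is, #C(σ) + #C(α) + #C(σα) = n + 2 − 2g for some integer g with 0 ≤ g ≤ ⌊(n−1)/2⌋. -/

import Mathlib

open MeasureTheory ProbabilityTheory Matrix Filter
open scoped ComplexOrder

noncomputable section

/-- The measurable space structure on complex matrices (entrywise/product σ-algebra). -/
instance matMS (N : ℕ) : MeasurableSpace (Matrix (Fin N) (Fin N) ℂ) :=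
  inferInstanceAs (MeasurableSpace (Fin N → Fin N → ℂ))

/-- The set of minimal representatives of the cycles of a permutation. -/
def cycleReps {β : Type*} [Fintype β] [LinearOrder β] (π : Equiv.Perm β) : Finset β :=
  Finset.univ.filter fun j => ∀ i ∈ Finset.range (Fintype.card β), j ≤ (π ^ i) j

/-- The number of cycles of a permutation (fixed points count as cycles of length one). -/
def cycleCount {β : Type*} [Fintype β] [LinearOrder β] (π : Equiv.Perm β) : ℕ :=
  (cycleReps π).card

/-- The product `f j * f (π j) * f (π² j) * ⋯` along the cycle of `π` containing `j`. -/
def cycleProd {β M : Type*} [Monoid M] (π : Equiv.Perm β) (f : β → M) (j : β) : M :=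
  ((List.range (Function.minimalPeriod ⇑π j)).map fun i => f ((π ^ i) j)).prod

/-- `q_{σ,t,h}(x₁,…,x_s) = ∏_{c ∈ C(σ)} tr (∏_{j ∈ c} h(j) x_{t(j)})`, the product inside each
trace being taken in the order in which the elements appear along the cycle. -/
def qMonomial {n N s : ℕ} (σ : Equiv.Perm (Fin n)) (t : Fin n → Fin s)
    (h : Fin n → Matrix (Fin N) (Fin N) ℂ) (x : Fin s → Matrix (Fin N) (Fin N) ℂ) : ℂ :=
  ∏ j ∈ cycleReps σ, (cycleProd σ (fun i => h i * x (t i)) j).trace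

/-- `p ∈ {1,…,N} ∪ (N,∞)`. -/
def ShapeParam (N : ℕ) (p : ℝ) : Prop :=
  (∃ k : ℕ, 1 ≤ k ∧ k ≤ N ∧ p = k) ∨ (N : ℝ) < p

/-- `W` has the complex Wishart law with scale `S` and shape `p`: it is Hermitian valued and its
Laplace transform is `det(I - θ S)^{-p}` for all Hermitian `θ` with `S⁻¹ - θ` positive definite. -/
def IsWishart {N : ℕ} {Ω : Type*} [MeasurableSpace Ω] (μ : Measure Ω)
    (W : Ω → Matrix (Fin N) (Fin N) ℂ) (S : Matrix (Fin N) (Fin N) ℂ) (p : ℝ) : Prop :=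
  (∀ ω, (W ω).IsHermitian) ∧
    ∀ θ : Matrix (Fin N) (Fin N) ℂ, θ.IsHermitian → (S⁻¹ - θ).PosDef →
      ∫ ω, Complex.exp ((θ * W ω).trace) ∂μ = (1 - θ * S).det ^ (-(p : ℂ))


section CycleCount

variable {β : Type*} [Fintype β] [LinearOrder β]

lemma mem_cycleReps_iff (π : Equiv.Perm β) (j : β) :
    j ∈ cycleReps π ↔ ∀ y, π.SameCycle j y → j ≤ y := by
  simp only [cycleReps, Finset.mem_filter, Finset.mem_univ, true_and, Finset.mem_range]
  refine ⟨fun h y hy => ?_, fun h i _ => h _ ⟨i, by simp⟩⟩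
  by_cases hj : π j = j
  · exact (hy.eq_of_left hj).le
  · obtain ⟨i, hi, rfl⟩ := hy.exists_pow_eq_of_mem_support (Equiv.Perm.mem_support.2 hj)
    exact h i (hi.trans_le (Finset.card_le_univ _))

lemma eq_of_mem_cycleReps {π : Equiv.Perm β} {i j : β} (hi : i ∈ cycleReps π)
    (hj : j ∈ cycleReps π) (h : π.SameCycle i j) : i = j :=
  le_antisymm ((mem_cycleReps_iff π i).1 hi j h) ((mem_cycleReps_iff π j).1 hj i h.symm)

lemma exists_mem_cycleReps (π : Equiv.Perm β) (x : β) :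
    ∃ j ∈ cycleReps π, π.SameCycle x j := by
  classical
  obtain ⟨j, hj, hmin⟩ := (Finset.univ.filter fun y => π.SameCycle x y).exists_min_image id
    ⟨x, Finset.mem_filter.2 ⟨Finset.mem_univ x, .refl π x⟩⟩
  simp only [Finset.mem_filter, Finset.mem_univ, true_and, id] at hj hmin
  exact ⟨j, (mem_cycleReps_iff π j).2 fun y hy => hmin y (hj.trans hy), hj⟩

lemma cycleCount_pos [Nonempty β] (π : Equiv.Perm β) : 0 < cycleCount π := by
  obtain ⟨j, hj, -⟩ := exists_mem_cycleReps π (Classical.arbitrary β)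
  exact Finset.card_pos.2 ⟨j, hj⟩

lemma cycleCount_add_card_support (π : Equiv.Perm β) :
    cycleCount π + π.support.card = Fintype.card β + π.cycleType.card := by
  have hfix : (cycleReps π).filter (fun j => π j = j) = π.supportᶜ := by
    ext j
    simp only [Finset.mem_filter, Finset.mem_compl, Equiv.Perm.mem_support, not_not,
      and_iff_right_iff_imp]
    exact fun hj => (mem_cycleReps_iff π j).2 fun y hy => (hy.eq_of_left hj).le
  have hmov : ((cycleReps π).filter (fun j => ¬ π j = j)).card = π.cycleFactorsFinset.card := by
    refine Finset.card_bij (fun j _ => π.cycleOf j) ?_ ?_ ?_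
    · intro j hj
      exact Equiv.Perm.cycleOf_mem_cycleFactorsFinset_iff.2
        (Equiv.Perm.mem_support.2 (Finset.mem_filter.1 hj).2)
    · intro i hi j hj h
      rw [Finset.mem_filter] at hi hj
      exact eq_of_mem_cycleReps hi.1 hj.1
        ((Equiv.Perm.sameCycle_iff_cycleOf_eq_of_mem_support (Equiv.Perm.mem_support.2 hi.2)
          (Equiv.Perm.mem_support.2 hj.2)).2 h)
    · intro c hc
      obtain ⟨x, hx⟩ := (Equiv.Perm.mem_cycleFactorsFinset_iff.1 hc).1.nonempty_support
      obtain ⟨j, hj, hxj⟩ := exists_mem_cycleReps π x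
      have hcx := Equiv.Perm.cycle_is_cycleOf hx hc
      have hxs := Equiv.Perm.mem_cycleFactorsFinset_support_le hc hx
      refine ⟨j, Finset.mem_filter.2 ⟨hj, ?_⟩, ?_⟩
      · rw [← hxj.apply_eq_self_iff]
        exact Equiv.Perm.mem_support.1 hxs
      · rw [hcx, hxj.cycleOf_eq]
  have hsplit := Finset.card_filter_add_card_filter_not (s := cycleReps π) (fun j => π j = j)
  have hsupp := Finset.card_compl_add_card π.support
  have htype : π.cycleType.card = π.cycleFactorsFinset.card := by
    simp [Equiv.Perm.cycleType_def]
  rw [hfix, hmov] at hsplit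
  rw [cycleCount]
  lia

lemma sign_eq_neg_one_pow_card_add_cycleCount (π : Equiv.Perm β) :
    Equiv.Perm.sign π = (-1) ^ (Fintype.card β + cycleCount π) := by
  rw [Equiv.Perm.sign_of_cycleType, Equiv.Perm.sum_cycleType]
  have h := cycleCount_add_card_support π
  exact neg_one_pow_congr (by grind)

lemma even_card_add_cycleCount (σ α : Equiv.Perm β) :
    Even (Fintype.card β + (cycleCount σ + cycleCount α + cycleCount (σ * α))) := by
  have h := Equiv.Perm.sign_mul σ α
  simp only [sign_eq_neg_one_pow_card_add_cycleCount, ← pow_add] at h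
  have h' : (-1 : ℤˣ) ^ (Fintype.card β + cycleCount (σ * α) +
      (Fintype.card β + cycleCount σ + (Fintype.card β + cycleCount α))) = 1 := by
    rw [pow_add, h, ← pow_add]
    exact Even.neg_one_pow ⟨_, rfl⟩
  have h'' := (neg_one_pow_eq_one_iff_even (by decide)).1 h'
  grind

lemma cycleCount_le_finrank_ker (π : Equiv.Perm β) :
    cycleCount π ≤ Module.finrank ℚ
      (LinearMap.ker ((1 : Module.End ℚ (β → ℚ)) - LinearMap.funLeft ℚ ℚ π)) := by
  classical
  let restr : LinearMap.ker ((1 : Module.End ℚ (β → ℚ)) - LinearMap.funLeft ℚ ℚ π) →ₗ[ℚ]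
      (cycleReps π → ℚ) :=
    (LinearMap.funLeft ℚ ℚ Subtype.val).comp (Submodule.subtype _)
  have hsurj : Function.Surjective restr := by
    intro g
    refine ⟨⟨fun x => ∑ j : cycleReps π, if π.SameCycle j x then g j else 0, ?_⟩, ?_⟩
    · rw [LinearMap.mem_ker]
      ext x
      simp [LinearMap.funLeft_apply]
    · ext i
      have h : ∀ j : cycleReps π, π.SameCycle j i ↔ j = i := fun j =>
        ⟨fun h => Subtype.ext (eq_of_mem_cycleReps j.2 i.2 h), fun h => h ▸ .refl _ _⟩
      simp [restr, LinearMap.funLeft_apply, h]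
  simpa [cycleCount] using LinearMap.finrank_le_finrank_of_surjective hsurj

end CycleCount

open Module LinearMap in
/-- Scott's inequality for a pair of endomorphisms. -/
lemma scott_inequality {K V : Type*} [Field K] [AddCommGroup V] [Module K V]
    [FiniteDimensional K V] (X Y : Module.End K V) :
    finrank K V + finrank K ↥(range (1 - X) ⊔ range (1 - Y)) ≤
      finrank K (range (1 - X)) + finrank K (range (1 - Y)) + finrank K (range (1 - X * Y)) +
        finrank K ↥(LinearMap.ker (1 - X) ⊓ LinearMap.ker (1 - Y)) := by
  let b : V →ₗ[K] range (1 - X) × range (1 - Y) × range (1 - X * Y) :=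
    (1 - X).rangeRestrict.prod ((1 - Y).rangeRestrict.prod (1 - X * Y).rangeRestrict)
  let d : range (1 - X) × range (1 - Y) × range (1 - X * Y) →ₗ[K] V :=
    (Submodule.subtype _).coprod
      ((X.comp (Submodule.subtype _)).coprod (-Submodule.subtype _))
  have hdb : range b ≤ LinearMap.ker d := by
    rintro _ ⟨v, rfl⟩
    simp [b, d]
  have hker : LinearMap.ker b ≤ LinearMap.ker (1 - X) ⊓ LinearMap.ker (1 - Y) := by
    intro v hv
    simp only [b, LinearMap.mem_ker, prod_apply, Function.prod, Prod.mk_eq_zero] at hv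
    simpa using And.intro (congrArg Subtype.val hv.1) (congrArg Subtype.val hv.2.1)
  have hX : range (1 - X) ≤ range d := by
    intro v hv
    exact ⟨(⟨v, hv⟩, 0, 0), by simp [d]⟩
  have hY : range (1 - Y) ≤ range d := by
    intro v hv
    exact ⟨(⟨(1 - X) v, v, rfl⟩, ⟨v, hv⟩, 0), by simp [d]⟩
  have h₁ := finrank_range_add_finrank_ker b
  have h₂ := finrank_range_add_finrank_ker d
  have h₃ := Submodule.finrank_mono hdb
  have h₄ := Submodule.finrank_mono hker
  have h₅ := Submodule.finrank_mono (sup_le hX hY)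
  simp only [finrank_prod] at h₂
  lia

section Transitive

variable {β : Type*} {σ α : Equiv.Perm β}

/-- An equivalence relation containing the steps of two permutations that generate a transitive
group is total. -/
lemma rel_of_transitive_pair
    (htrans : ∀ x y : β, ∃ g ∈ Subgroup.closure ({σ, α} : Set (Equiv.Perm β)), g x = y)
    (r : Setoid β) (hσ : ∀ x, r x (σ x)) (hα : ∀ x, r x (α x)) (x y : β) : r x y := by
  obtain ⟨g, hg, rfl⟩ := htrans x y
  clear htrans
  induction hg using Subgroup.closure_induction generalizing x with
  | mem g hg =>
    rcases hg with rfl | rfl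
    exacts [hσ x, hα x]
  | one => exact r.refl x
  | mul g h _ _ ihg ihh => exact r.trans (ihh x) (ihg (h x))
  | inv g _ ih => simpa using r.symm (ih (g⁻¹ x))

open Module LinearMap

lemma finrank_ker_inf_ker_le_one
    (htrans : ∀ x y : β, ∃ g ∈ Subgroup.closure ({σ, α} : Set (Equiv.Perm β)), g x = y) :
    finrank ℚ ↥(LinearMap.ker (1 - funLeft ℚ ℚ α : Module.End ℚ (β → ℚ)) ⊓
      LinearMap.ker (1 - funLeft ℚ ℚ σ : Module.End ℚ (β → ℚ))) ≤ 1 := by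
  refine (Submodule.finrank_mono (t := Submodule.span ℚ {1}) ?_).trans
    ((finrank_span_le_card _).trans (by simp))
  intro f hf
  simp only [Submodule.mem_inf, LinearMap.mem_ker, LinearMap.sub_apply, End.one_apply,
    sub_eq_zero] at hf
  rw [Submodule.mem_span_singleton]
  cases isEmpty_or_nonempty β with
  | inl _ => exact ⟨0, Subsingleton.elim _ _⟩
  | inr h =>
    obtain ⟨a⟩ := h
    refine ⟨f a, funext fun x => ?_⟩
    simpa using rel_of_transitive_pair htrans (Setoid.ker f) (fun x => congrFun hf.2 x)
      (fun x => congrFun hf.1 x) a x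

lemma card_le_finrank_range_sup_range_add_one [Fintype β]
    (htrans : ∀ x y : β, ∃ g ∈ Subgroup.closure ({σ, α} : Set (Equiv.Perm β)), g x = y) :
    Fintype.card β ≤ finrank ℚ ↥(range (1 - funLeft ℚ ℚ α : Module.End ℚ (β → ℚ)) ⊔
      range (1 - funLeft ℚ ℚ σ : Module.End ℚ (β → ℚ))) + 1 := by
  classical
  cases isEmpty_or_nonempty β with
  | inl _ => simp
  | inr h =>
    obtain ⟨a⟩ := h
    set S := range (1 - funLeft ℚ ℚ α : Module.End ℚ (β → ℚ)) ⊔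
      range (1 - funLeft ℚ ℚ σ : Module.End ℚ (β → ℚ))
    let e : β → β → ℚ := fun x => Pi.single x 1
    have hstep (π : Equiv.Perm β) (x : β) :
        (1 - funLeft ℚ ℚ π : Module.End ℚ (β → ℚ)) (e (π x)) = e (π x) - e x := by
      ext y
      simp [e, funLeft_apply, Pi.single_apply]
    let r : Setoid β := (QuotientAddGroup.leftRel S.toAddSubgroup).comap e
    have hr (x y : β) : r x y ↔ e y - e x ∈ S := by
      rw [Setoid.comap_rel, QuotientAddGroup.leftRel_apply, neg_add_eq_sub]
      rfl
    have hmem (x : β) : e x - e a ∈ S :=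
      (hr a x).1 <| rel_of_transitive_pair htrans r
        (fun x => (hr _ _).2 (Submodule.mem_sup_right ⟨_, hstep σ x⟩))
        (fun x => (hr _ _).2 (Submodule.mem_sup_left ⟨_, hstep α x⟩)) a x
    have htop : S ⊔ Submodule.span ℚ {e a} = ⊤ := by
      rw [eq_top_iff, ← (Pi.basisFun ℚ β).span_eq, Submodule.span_le]
      rintro _ ⟨x, rfl⟩
      rw [Pi.basisFun_apply, SetLike.mem_coe, ← sub_add_cancel (Pi.single x 1) (e a)]
      exact Submodule.add_mem_sup (hmem x) (Submodule.mem_span_singleton_self _)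
    have hle := Submodule.finrank_add_le_finrank_add_finrank S (Submodule.span ℚ {e a})
    have hone : finrank ℚ (Submodule.span ℚ {e a}) ≤ 1 :=
      (finrank_span_le_card _).trans (by simp)
    rw [htop, finrank_top, finrank_fintype_fun_eq_card] at hle
    lia

end Transitive

/-- The Riemann–Hurwitz inequality for a transitive pair of permutations. -/
lemma cycleCount_add_le_of_transitive_pair {β : Type*} [Fintype β] [LinearOrder β]
    {σ α : Equiv.Perm β}
    (htrans : ∀ x y : β, ∃ g ∈ Subgroup.closure ({σ, α} : Set (Equiv.Perm β)), g x = y) :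
    cycleCount σ + cycleCount α + cycleCount (σ * α) ≤ Fintype.card β + 2 := by
  have hmul : (LinearMap.funLeft ℚ ℚ α * LinearMap.funLeft ℚ ℚ σ : Module.End ℚ (β → ℚ)) =
      LinearMap.funLeft ℚ ℚ (σ * α) := rfl
  have hscott := scott_inequality (LinearMap.funLeft ℚ ℚ α : Module.End ℚ (β → ℚ))
    (LinearMap.funLeft ℚ ℚ σ)
  rw [hmul, Module.finrank_fintype_fun_eq_card] at hscott
  have hinf := finrank_ker_inf_ker_le_one htrans
  have hsup := card_le_finrank_range_sup_range_add_one htrans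
  have hrank (π : Equiv.Perm β) := LinearMap.finrank_range_add_finrank_ker
    (1 - LinearMap.funLeft ℚ ℚ π : Module.End ℚ (β → ℚ))
  simp only [Module.finrank_fintype_fun_eq_card] at hrank
  have h₁ := hrank σ
  have h₂ := hrank α
  have h₃ := hrank (σ * α)
  have k₁ := cycleCount_le_finrank_ker σ
  have k₂ := cycleCount_le_finrank_ker α
  have k₃ := cycleCount_le_finrank_ker (σ * α)
  lia

/-- Euler-characteristic/genus formula for a pair of permutations acting transitively:
`#C(σ) + #C(α) + #C(σα) = n + 2 − 2g` for some integer `0 ≤ g ≤ ⌊(n−1)/2⌋`. -/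
theorem genus_of_transitive_pair
    {n : ℕ} (hn : 1 ≤ n) (σ α : Equiv.Perm (Fin n))
    (htrans : ∀ x y : Fin n,
      ∃ g ∈ Subgroup.closure ({σ, α} : Set (Equiv.Perm (Fin n))), g x = y) :
    ∃ g : ℕ, g ≤ (n - 1) / 2 ∧
      cycleCount σ + cycleCount α + cycleCount (σ * α) + 2 * g = n + 2 := by
  have : Nonempty (Fin n) := ⟨⟨0, hn⟩⟩
  have hle := cycleCount_add_le_of_transitive_pair htrans
  have heven := even_card_add_cycleCount σ α
  have hσ := cycleCount_pos σ
  have hα := cycleCount_pos α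
  have hσα := cycleCount_pos (σ * α)
  rw [Fintype.card_fin] at hle heven
  obtain ⟨k, hk⟩ := heven
  exact ⟨n + 1 - k, by lia, by lia⟩

end
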